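/- Let f : A → B be a homomorphism of abelian groups such that for every integer m ≥ 2 the induced map A ⊗ ℤ/m → B ⊗ ℤ/m is injective and the induced map A[m] → B[m] on m-torsion subgroups is surjective. If there exists a nonzero natural number N such that N·x = 0 for every x in the kernel of f, then f is injective. -/

import Mathlib

/-- If `a ⊗ 1` vanishes in `A ⊗ ℤ/m`, then `a` is divisible by `m`. -/
theorem exists_nsmul_eq_of_tmul_one_eq_zero {A : Type*} [AddCommGroup A] (m : ℕ) {a : A}
    (h : TensorProduct.tmul ℤ a (1 : ZMod m) = 0) : ∃ y : A, m • y = a := by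
  let g : ℤ →ₗ[ℤ] ZMod m := (Int.castAddHom (ZMod m)).toIntLinearMap
  let μ : ℤ →ₗ[ℤ] ℤ := LinearMap.lsmul ℤ ℤ (m : ℤ)
  have hexact : Function.Exact μ g := fun k => by
    change ((k : ZMod m) = 0) ↔ ∃ l : ℤ, (m : ℤ) * l = k
    rw [CharP.intCast_eq_zero_iff (ZMod m) m]
    exact exists_congr fun _ => eq_comm
  obtain ⟨t, ht⟩ := (lTensor_exact A hexact ZMod.intCast_surjective
    (TensorProduct.tmul ℤ a (1 : ℤ))).1 (by simpa [g] using h)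
  have hμ : μ.lTensor A t = (m : ℤ) • t := by
    have : μ = (m : ℤ) • LinearMap.id := rfl
    rw [this, LinearMap.lTensor_smul, LinearMap.lTensor_id]
    rfl
  refine ⟨TensorProduct.rid ℤ A t, ?_⟩
  rw [← natCast_zsmul, ← map_zsmul, ← hμ, ht, TensorProduct.rid_tmul, one_smul]

/-- If `f : A → B` is a homomorphism of abelian groups such that for every integer `m ≥ 2`
the induced map `A ⊗ ℤ/m → B ⊗ ℤ/m` is injective and the induced map `A[m] → B[m]` on
`m`-torsion subgroups is surjective, and if there is a nonzero natural number `N` with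
`N • x = 0` for every `x` in the kernel of `f`, then `f` is injective. -/
theorem stmt_5 {A B : Type*} [AddCommGroup A] [AddCommGroup B] (f : A →+ B)
    (htensor : ∀ m : ℕ, 2 ≤ m →
      Function.Injective (LinearMap.rTensor (ZMod m) f.toIntLinearMap))
    (htors : ∀ m : ℕ, 2 ≤ m → ∀ b : B, m • b = 0 → ∃ a : A, m • a = 0 ∧ f a = b)
    (hN : ∃ N : ℕ, N ≠ 0 ∧ ∀ x ∈ f.ker, N • x = 0) :
    Function.Injective f := by
  obtain ⟨N, hN0, hN⟩ := hN
  have hm : 2 ≤ 2 * N := by lia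
  rw [injective_iff_map_eq_zero]
  intro x hx
  obtain ⟨y, rfl⟩ := exists_nsmul_eq_of_tmul_one_eq_zero (2 * N) (a := x) <|
    htensor (2 * N) hm (by simp [hx])
  obtain ⟨a, ha, hay⟩ := htors (2 * N) hm (f y) (by rw [← map_nsmul, hx])
  have hker : N • (y - a) = 0 := hN _ (by simp [AddMonoidHom.mem_ker, hay])
  have hsub : (2 * N) • (y - a) = 0 := by rw [mul_nsmul', hker, nsmul_zero]
  rwa [nsmul_sub, ha, sub_zero] at hsub
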